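/- (Anchored commitment uniqueness; detection of deletion and injection.) Let h : β → α be an injective leaf-hash function and H : α → α → α a pairwise injective combiner. If two nonempty logs L and L' satisfy both L.length = L'.length and root(L.map h) = root(L'.map h), then L = L'. Consequently, anchoring the pair (entry count, Merkle root) uniquely determines the log: any deletion or injection of entries changes the entry count, and any same-length substitution changes the root. -/

import Mathlib

/-- Side of a sibling hash in an inclusion proof. -/
inductive Side
  | left
  | right
deriving DecidableEq, Repr

/-- One Merkle level step: combine consecutive pairs with `H`,
promoting an unpaired final element unchanged. -/
def levelStep {α : Type*} (H : α → α → α) : List α → List α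
  | a :: b :: rest => H a b :: levelStep H rest
  | l => l

theorem levelStep_length {α : Type*} (H : α → α → α) :
    (l : List α) → (levelStep H l).length = (l.length + 1) / 2
  | [] => by simp [levelStep]
  | [_] => by simp [levelStep]
  | a :: b :: rest => by
      simp only [levelStep, List.length_cons, levelStep_length H rest]
      omega

/-- The Merkle root of a list of leaf hashes (`none` on the empty list),
obtained by iterating the level step until a single hash remains. -/
def merkleRoot? {α : Type*} (H : α → α → α) : List α → Option α
  | [] => none
  | [a] => some a
  | a :: b :: rest => merkleRoot? H (levelStep H (a :: b :: rest))
termination_by l => l.length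
decreasing_by
  simp only [levelStep_length, List.length_cons]
  omega

theorem levelStep_inj_aux {α : Type*} (H : α → α → α)
    (hH : ∀ a b c d : α, H a b = H c d → a = c ∧ b = d) :
    (l l' : List α) → l.length = l'.length → levelStep H l = levelStep H l' → l = l'
  | [], [], _, _ => rfl
  | [], _ :: _, h, _ => by simp at h
  | _ :: _, [], h, _ => by simp at h
  | [a], [b], _, h => by simpa [levelStep] using h
  | [_], _ :: _ :: _, h, _ => by simp at h
  | _ :: _ :: _, [_], h, _ => by simp at h
  | a :: b :: r, c :: d :: r', hl, h => by
      simp only [levelStep, List.cons.injEq] at h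
      obtain ⟨h1, h2⟩ := h
      obtain ⟨rfl, rfl⟩ := hH _ _ _ _ h1
      have := levelStep_inj_aux H hH r r' (by simpa using hl) h2
      rw [this]

theorem merkleRoot_inj_aux {α : Type*} (H : α → α → α)
    (hH : ∀ a b c d : α, H a b = H c d → a = c ∧ b = d) (n : ℕ) :
    ∀ l l' : List α, l.length = n → l'.length = n →
      merkleRoot? H l = merkleRoot? H l' → l = l' := by
  induction n using Nat.strong_induction_on with
  | _ n ih =>
    intro l l' hl hl' h
    match l, l', hl, hl', h with
    | [], [], _, _, _ => rfl
    | [], _ :: _, h1, h2, _ => simp at h1 h2; omega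
    | _ :: _, [], h1, h2, _ => simp at h1 h2; omega
    | [a], [b], _, _, h => simpa [merkleRoot?] using h
    | [_], _ :: _ :: _, h1, h2, _ => simp at h1 h2; omega
    | _ :: _ :: _, [_], h1, h2, _ => simp at h1 h2; omega
    | a :: b :: r, c :: d :: r', h1, h2, h =>
      rw [merkleRoot?, merkleRoot?] at h
      apply levelStep_inj_aux H hH _ _ (h1.trans h2.symm)
      refine ih ((n + 1) / 2) ?_ _ _ ?_ ?_ h
      · simp at h1; omega
      · rw [levelStep_length, h1]
      · rw [levelStep_length, h2]

/-- **Anchored commitment uniqueness; detection of deletion and injection.**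
With an injective leaf-hash function `hf` and a pairwise injective combiner
`H`, two nonempty logs with the same entry count and the same Merkle root over
their leaf hashes must be identical. Hence anchoring the pair
(entry count, Merkle root) uniquely determines the log. -/
theorem log_eq_of_length_eq_of_root_eq {α β : Type*} (hf : β → α)
    (hfinj : Function.Injective hf) (H : α → α → α)
    (hH : ∀ a b c d : α, H a b = H c d → a = c ∧ b = d)
    (L L' : List β) (hne : L ≠ []) (hne' : L' ≠ [])
    (hlen : L.length = L'.length)
    (hroot : merkleRoot? H (L.map hf) = merkleRoot? H (L'.map hf)) :
    L = L' := by
  apply hfinj.list_map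
  exact merkleRoot_inj_aux H hH L.length _ _ (by simp) (by simp [hlen]) hroot
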